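/- Let C ⊆ ℝ × S¹ be an embedded circle homotopic to {*} × S¹ in the cylinder. Then ℝ × S¹ ∖ C has exactly two connected components, one containing an end neighborhood (−∞, −T) × S¹ and the other containing (T, ∞) × S¹ for T large enough. -/

import Mathlib

open Set

section Logarithms

variable {X : Type*} [TopologicalSpace X]

/-- The end maps of a homotopy of nowhere vanishing functions differ by an exponential factor. -/
theorem exists_eq_mul_exp_of_homotopy {H : unitInterval × X → ℂ} (hH : Continuous H)
    (hne : ∀ p, H p ≠ 0) : ∃ g : C(X, ℂ), ∀ x, H (1, x) = H (0, x) * Complex.exp (g x) := by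
  let K : C(unitInterval × X, {z : ℂ // z ≠ 0}) :=
    ⟨fun p ↦ ⟨H p / H (0, p.2), div_ne_zero (hne _) (hne _)⟩,
      Continuous.subtype_mk (hH.div (by fun_prop) fun p ↦ hne _) _⟩
  have hK : ∀ x, K (0, x) = ⟨_, Complex.exp_ne_zero ((0 : C(X, ℂ)) x)⟩ := fun x ↦
    Subtype.ext (by simp [K, hne])
  let L := Complex.isCoveringMap_exp.liftHomotopy K 0 hK
  refine ⟨L.comp ⟨fun x ↦ (1, x), by fun_prop⟩, fun x ↦ ?_⟩
  have h : Complex.exp (L (1, x)) = H (1, x) / H (0, x) :=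
    congrArg Subtype.val (congrFun (Complex.isCoveringMap_exp.liftHomotopy_lifts K 0 hK) (1, x))
  simp [h, mul_div_cancel₀ _ (hne (0, x))]

/-- A perturbation of `h` by a function of smaller norm differs from `h` by an exponential
factor. -/
theorem exists_sub_eq_mul_exp_of_norm_lt {f h : X → ℂ} (hf : Continuous f) (hh : Continuous h)
    (hlt : ∀ x, ‖f x‖ < ‖h x‖) : ∃ g : C(X, ℂ), ∀ x, h x - f x = h x * Complex.exp (g x) := by
  have hne : ∀ x, h x ≠ 0 := fun x ↦ norm_pos_iff.1 ((norm_nonneg _).trans_lt (hlt x))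
  have hmem : ∀ x, 1 - f x / h x ∈ Complex.slitPlane := fun x ↦ by
    rw [sub_eq_add_neg]
    apply Complex.mem_slitPlane_of_norm_lt_one
    rw [norm_neg, norm_div]
    exact (div_lt_one (norm_pos_iff.2 (hne x))).2 (hlt x)
  refine ⟨⟨fun x ↦ Complex.log (1 - f x / h x),
    (continuous_const.sub (hf.div hh hne)).clog hmem⟩, fun x ↦ ?_⟩
  have := hne x
  simp only [ContinuousMap.coe_mk]
  rw [Complex.exp_log (Complex.slitPlane_ne_zero (hmem x))]
  field_simp

end Logarithms

section Degree

theorem AddCircle.toCircle_coe_eq_exp (x : ℝ) :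
    ((AddCircle.toCircle (x : AddCircle (1 : ℝ)) : Circle) : ℂ) =
      Complex.exp (x * (2 * Real.pi * Complex.I)) := by
  rw [AddCircle.toCircle_apply_mk, Circle.coe_exp]
  congr 1
  push_cast
  ring

/-- The standard map from the circle to `ℂ` has no continuous logarithm. -/
theorem AddCircle.not_exists_toCircle_eq_exp :
    ¬ ∃ g : C(AddCircle (1 : ℝ), ℂ), ∀ t, (AddCircle.toCircle t : ℂ) = Complex.exp (g t) := by
  rintro ⟨g, hg⟩
  have h := Complex.isCoveringMap_exp.eq_of_comp_eq
    (g₁ := fun x : ℝ ↦ g (x : AddCircle (1 : ℝ)))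
    (g₂ := fun x : ℝ ↦ (x : ℂ) * (2 * Real.pi * Complex.I) + g 0)
    (by fun_prop) (by fun_prop) (by
      funext x
      simp [← hg, AddCircle.toCircle_coe_eq_exp, Complex.exp_add]) 0 (by simp)
  have h1 := congrFun h 1
  have hp : ((1 : ℝ) : AddCircle (1 : ℝ)) = 0 := AddCircle.coe_period 1
  simp [hp, Real.pi_ne_zero] at h1

/-- A nowhere vanishing function on the circle is a power of the standard one up to an exponential
factor. -/
theorem AddCircle.exists_eq_toCircle_zpow_mul_exp {f : AddCircle (1 : ℝ) → ℂ} (hf : Continuous f)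
    (hne : ∀ t, f t ≠ 0) : ∃ (d : ℤ) (g : C(AddCircle (1 : ℝ), ℂ)),
      ∀ t, f t = (AddCircle.toCircle t : ℂ) ^ d * Complex.exp (g t) := by
  let F : C(ℝ, {z : ℂ // z ≠ 0}) :=
    ⟨fun x ↦ ⟨f (x : AddCircle (1 : ℝ)), hne _⟩, Continuous.subtype_mk (by fun_prop) _⟩
  obtain ⟨G, ⟨-, hG⟩, -⟩ := Complex.isCoveringMap_exp.existsUnique_continuousMap_lifts F 0
    (Complex.log (f (0 : ℝ))) (Subtype.ext (Complex.exp_log (hne _)))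
  have hGf : ∀ x : ℝ, Complex.exp (G x) = f (x : AddCircle (1 : ℝ)) := fun x ↦
    congrArg Subtype.val (congrFun hG x)
  have hp : ((1 : ℝ) : AddCircle (1 : ℝ)) = ((0 : ℝ) : AddCircle (1 : ℝ)) :=
    AddCircle.coe_period 1
  obtain ⟨d, hd⟩ := Complex.exp_eq_exp_iff_exists_int.1
    ((hGf 1).trans ((congrArg f hp).trans (hGf 0).symm))
  let g : ℝ → ℂ := fun x ↦ G x - d * (x * (2 * Real.pi * Complex.I))
  refine ⟨d, ⟨AddCircle.liftIco 1 0 g, AddCircle.liftIco_zero_continuous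
    (by simp [g, hd]) (by fun_prop)⟩, fun t ↦ ?_⟩
  obtain ⟨x, hx, rfl⟩ := AddCircle.eq_coe_Ico t
  rw [ContinuousMap.coe_mk, AddCircle.liftIco_coe_apply (by simpa using hx),
    AddCircle.toCircle_coe_eq_exp, ← Complex.exp_int_mul, ← Complex.exp_add, ← hGf]
  simp [g]

instance AddCircle.locallyPathConnectedSpace : LocallyPathConnectedSpace (AddCircle (1 : ℝ)) :=
  QuotientAddGroup.isOpenQuotientMap_mk.isQuotientMap.locallyPathConnectedSpace

end Degree

section Components

variable {X : Type*} [TopologicalSpace X] [LocallyConnectedSpace X]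

theorem IsOpen.frontier_connectedComponentIn_subset {F : Set X} (hF : IsOpen F) (x : X) :
    frontier (connectedComponentIn F x) ⊆ Fᶜ := by
  intro y hy hyF
  obtain ⟨z, hzy, hzx⟩ := mem_closure_iff.1 hy.1 _ (hF.connectedComponentIn (x := y))
    (mem_connectedComponentIn hyF)
  apply hy.2
  rw [hF.connectedComponentIn.interior_eq, connectedComponentIn_eq hzx,
    ← connectedComponentIn_eq hzy]
  exact mem_connectedComponentIn hyF

end Components

/-- The homeomorphism of the cylinder onto the punctured plane, as a map into `ℂ`. -/
noncomputable def cylinderExp (p : ℝ × AddCircle (1 : ℝ)) : ℂ :=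
  Complex.exp p.1 * AddCircle.toCircle p.2

namespace cylinderExp

@[fun_prop]
theorem continuous : Continuous cylinderExp := by
  unfold cylinderExp
  fun_prop

theorem ne_zero (p : ℝ × AddCircle (1 : ℝ)) : cylinderExp p ≠ 0 :=
  mul_ne_zero (Complex.exp_ne_zero _) (Circle.coe_ne_zero _)

theorem norm_eq (p : ℝ × AddCircle (1 : ℝ)) : ‖cylinderExp p‖ = Real.exp p.1 := by
  rw [cylinderExp, norm_mul, Circle.norm_coe, mul_one, Complex.norm_exp, Complex.ofReal_re]

theorem injective : Function.Injective cylinderExp := by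
  rintro ⟨x, s⟩ ⟨y, t⟩ h
  have hxy : x = y := Real.exp_injective (by simpa [norm_eq] using congrArg norm h)
  subst hxy
  have hst := mul_left_cancel₀ (Complex.exp_ne_zero _) h
  exact Prod.ext rfl (AddCircle.injective_toCircle one_ne_zero (Subtype.ext hst))

theorem sub_ne_zero {p q : ℝ × AddCircle (1 : ℝ)} (h : p ≠ q) :
    cylinderExp p - cylinderExp q ≠ 0 :=
  _root_.sub_ne_zero.2 (injective.ne h)

end cylinderExp

section EssentialLoop

variable {γ : C(AddCircle (1 : ℝ), ℝ × AddCircle (1 : ℝ))}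

theorem exists_cylinderExp_eq_toCircle_mul_exp
    (hhom : γ.Homotopic ⟨fun t => ((0 : ℝ), t), by continuity⟩) :
    ∃ g : C(AddCircle (1 : ℝ), ℂ),
      ∀ t, cylinderExp (γ t) = AddCircle.toCircle t * Complex.exp (g t) := by
  obtain ⟨H⟩ := hhom.symm
  obtain ⟨g, hg⟩ := exists_eq_mul_exp_of_homotopy (H := fun p ↦ cylinderExp (H p))
    (by fun_prop) fun p ↦ cylinderExp.ne_zero _
  refine ⟨g, fun t ↦ ?_⟩
  simpa [cylinderExp] using hg t

/-- No path in the complement of an essential loop joins the two ends of the cylinder. -/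
theorem not_joinedIn_compl_range_of_norm_lt
    (hhom : γ.Homotopic ⟨fun t => ((0 : ℝ), t), by continuity⟩)
    {a b : ℝ × AddCircle (1 : ℝ)} (ha : ∀ t, a.1 < (γ t).1) (hb : ∀ t, (γ t).1 < b.1) :
    ¬ JoinedIn (range γ)ᶜ b a := by
  rintro ⟨c, hc⟩
  obtain ⟨g, hg⟩ := exists_cylinderExp_eq_toCircle_mul_exp hhom
  obtain ⟨k, hk⟩ := exists_eq_mul_exp_of_homotopy
    (H := fun p : unitInterval × AddCircle (1 : ℝ) ↦ cylinderExp (c p.1) - cylinderExp (γ p.2))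
    (by fun_prop) fun p ↦ cylinderExp.sub_ne_zero fun h ↦ hc p.1 ⟨p.2, h.symm⟩
  obtain ⟨ga, hga⟩ := exists_sub_eq_mul_exp_of_norm_lt
    (f := fun _ ↦ cylinderExp a) (h := fun t ↦ cylinderExp (γ t)) (by fun_prop) (by fun_prop)
    fun t ↦ by simpa [cylinderExp.norm_eq] using ha t
  obtain ⟨gb, hgb⟩ := exists_sub_eq_mul_exp_of_norm_lt
    (f := fun t ↦ cylinderExp (γ t)) (h := fun _ ↦ cylinderExp b) (by fun_prop) (by fun_prop)
    fun t ↦ by simpa [cylinderExp.norm_eq] using hb t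
  refine AddCircle.not_exists_toCircle_eq_exp
    ⟨gb + k - ga - g + .const _ (Complex.log (-cylinderExp b)), fun t ↦ ?_⟩
  have h := hk t
  simp only [c.source, c.target] at h
  rw [hgb, ← neg_sub, hga, hg] at h
  simp only [ContinuousMap.add_apply, ContinuousMap.sub_apply, ContinuousMap.const_apply,
    Complex.exp_add, Complex.exp_sub,
    Complex.exp_log (neg_ne_zero.2 (cylinderExp.ne_zero b))]
  field_simp
  linear_combination -h

/-- A component of the complement of an embedded essential loop is unbounded. -/
theorem exists_mem_connectedComponentIn_compl_range (hinj : Function.Injective γ)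
    (hhom : γ.Homotopic ⟨fun t => ((0 : ℝ), t), by continuity⟩)
    {a : ℝ × AddCircle (1 : ℝ)} (ha : a ∉ range γ) (T : ℝ) :
    ∃ p ∈ connectedComponentIn (range γ)ᶜ a, T < |p.1| := by
  classical
  by_contra! hbd
  set W := connectedComponentIn (range γ)ᶜ a
  have hC : IsOpen (range γ)ᶜ := (isCompact_range γ.continuous).isClosed.isOpen_compl
  have haW : a ∈ W := mem_connectedComponentIn ha
  obtain ⟨g, hg⟩ := exists_cylinderExp_eq_toCircle_mul_exp hhom
  obtain ⟨d, k, hk⟩ := AddCircle.exists_eq_toCircle_zpow_mul_exp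
    (f := fun t ↦ cylinderExp (γ t) - cylinderExp a) (by fun_prop)
    fun t ↦ cylinderExp.sub_ne_zero fun h ↦ ha ⟨t, h⟩
  obtain ⟨G, hG⟩ := ContinuousMap.exists_extension' (γ.continuous.isClosedEmbedding hinj)
    (k - d • g)
  let F : ℝ × AddCircle (1 : ℝ) → ℂ := fun p ↦
    if p ∈ W then cylinderExp p ^ d * Complex.exp (G p) else cylinderExp p - cylinderExp a
  have hFc : Continuous F := by
    refine Continuous.if (fun p hp ↦ ?_)
      ((cylinderExp.continuous.zpow₀ d fun p ↦ .inl (cylinderExp.ne_zero p)).mul (by fun_prop))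
      (by fun_prop)
    obtain ⟨t, rfl⟩ := not_not.1 (hC.frontier_connectedComponentIn_subset a hp)
    have hGt : G (γ t) = k t - d * g t := by simpa using congrFun hG t
    rw [hk, hg, hGt, mul_zpow, ← Complex.exp_int_mul, mul_assoc, ← Complex.exp_add]
    ring_nf
  have hFne : ∀ p, F p ≠ 0 := by
    intro p
    by_cases hp : p ∈ W
    · simpa [F, hp] using zpow_ne_zero d (cylinderExp.ne_zero p)
    · have hpa : p ≠ a := fun h ↦ hp (h ▸ haW)
      simpa [F, hp] using cylinderExp.sub_ne_zero hpa
  obtain ⟨R, hR⟩ := exists_gt (max |a.1| T)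
  obtain ⟨haR, hTR⟩ := max_lt_iff.1 hR
  obtain ⟨haR', haR''⟩ := abs_lt.1 haR
  have hR0 : 0 < R := (abs_nonneg _).trans_lt haR
  have hFR : ∀ t, F (R, t) = cylinderExp (R, t) - cylinderExp a := fun t ↦
    if_neg fun h ↦ ((hbd _ h).trans_lt hTR).ne (abs_of_pos hR0)
  have hFR' : ∀ t, F (-R, t) = cylinderExp (-R, t) - cylinderExp a := fun t ↦
    if_neg fun h ↦ ((hbd _ h).trans_lt hTR).ne (by rw [abs_neg, abs_of_pos hR0])
  obtain ⟨m, hm⟩ := exists_eq_mul_exp_of_homotopy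
    (H := fun p : unitInterval × AddCircle (1 : ℝ) ↦ F ((2 * (p.1 : ℝ) - 1) * R, p.2))
    (by fun_prop) fun p ↦ hFne _
  obtain ⟨u, hu⟩ := exists_sub_eq_mul_exp_of_norm_lt
    (f := fun _ : AddCircle (1 : ℝ) ↦ cylinderExp a) (h := fun t ↦ cylinderExp (R, t))
    (by fun_prop) (by fun_prop) fun t ↦ by simpa [cylinderExp.norm_eq] using haR''
  obtain ⟨v, hv⟩ := exists_sub_eq_mul_exp_of_norm_lt
    (f := fun t : AddCircle (1 : ℝ) ↦ cylinderExp (-R, t)) (h := fun _ ↦ cylinderExp a)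
    (by fun_prop) (by fun_prop) fun t ↦ by simpa [cylinderExp.norm_eq] using haR'
  refine AddCircle.not_exists_toCircle_eq_exp
    ⟨v + m - u + .const _ (Complex.log (-cylinderExp a) - R), fun t ↦ ?_⟩
  have h := hm t
  rw [show (2 * ((1 : unitInterval) : ℝ) - 1) * R = R by norm_num,
    show (2 * ((0 : unitInterval) : ℝ) - 1) * R = -R by norm_num, hFR, hFR', hu, ← neg_sub, hv] at h
  simp only [ContinuousMap.add_apply, ContinuousMap.sub_apply, ContinuousMap.const_apply,
    Complex.exp_add, Complex.exp_sub,
    Complex.exp_log (neg_ne_zero.2 (cylinderExp.ne_zero a))]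
  field_simp
  simp only [cylinderExp] at h ⊢
  linear_combination h

end EssentialLoop

/-- Jordan-type theorem on the open cylinder `ℝ × S¹`: an embedded circle
`C ⊆ ℝ × S¹` homotopic to `{*} × S¹` separates the cylinder into exactly two
connected components, one containing an end neighborhood `(−∞, −T) × S¹` and
the other containing `(T, ∞) × S¹` for `T` large enough. -/
theorem cylinder_jordan_separation
    (γ : C(AddCircle (1 : ℝ), ℝ × AddCircle (1 : ℝ)))
    (hinj : Function.Injective γ)
    (hhom : γ.Homotopic ⟨fun t => ((0 : ℝ), t), by continuity⟩) :
    ∃ T : ℝ, 0 < T ∧ ∃ U V : Set (ℝ × AddCircle (1 : ℝ)),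
      IsOpen U ∧ IsOpen V ∧ IsConnected U ∧ IsConnected V ∧
      U ∩ V = ∅ ∧ U ∪ V = (Set.range γ)ᶜ ∧
      (Set.Iio (-T) ×ˢ (univ : Set (AddCircle (1 : ℝ)))) ⊆ U ∧
      (Set.Ioi T ×ˢ (univ : Set (AddCircle (1 : ℝ)))) ⊆ V := by
  have hC : IsOpen (range γ)ᶜ := (isCompact_range γ.continuous).isClosed.isOpen_compl
  obtain ⟨T, hT0, hT⟩ : ∃ T : ℝ, 0 < T ∧ ∀ t, |(γ t).1| ≤ T := by
    obtain ⟨M, hM⟩ := (isCompact_range (f := fun t ↦ |(γ t).1|) (by fun_prop)).bddAbove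
    exact ⟨max M 1, by positivity, fun t ↦ (hM ⟨t, rfl⟩).trans (le_max_left _ _)⟩
  have hlo : ∀ {p : ℝ × AddCircle (1 : ℝ)}, p.1 < -T → ∀ t, p.1 < (γ t).1 := fun hp t ↦
    hp.trans_le (abs_le.1 (hT t)).1
  have hhi : ∀ {p : ℝ × AddCircle (1 : ℝ)}, T < p.1 → ∀ t, (γ t).1 < p.1 := fun hp t ↦
    (abs_le.1 (hT t)).2.trans_lt hp
  let a : ℝ × AddCircle (1 : ℝ) := (-T - 1, 0)
  let b : ℝ × AddCircle (1 : ℝ) := (T + 1, 0)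
  have haT : a.1 < -T := by simp [a]
  have hbT : T < b.1 := by simp [b]
  have haC : a ∈ (range γ)ᶜ := by rintro ⟨t, h⟩; exact (hlo haT t).ne (by rw [h])
  have hbC : b ∈ (range γ)ᶜ := by rintro ⟨t, h⟩; exact (hhi hbT t).ne (by rw [h])
  have hU : Iio (-T) ×ˢ (univ : Set (AddCircle (1 : ℝ))) ⊆ connectedComponentIn (range γ)ᶜ a :=
    (isPreconnected_Iio.prod isPreconnected_univ).subset_connectedComponentIn ⟨haT, trivial⟩ <| by
      rintro p ⟨hp, -⟩ ⟨t, h⟩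
      exact (hlo hp t).ne (by rw [h])
  have hV : Ioi T ×ˢ (univ : Set (AddCircle (1 : ℝ))) ⊆ connectedComponentIn (range γ)ᶜ b :=
    (isPreconnected_Ioi.prod isPreconnected_univ).subset_connectedComponentIn ⟨hbT, trivial⟩ <| by
      rintro p ⟨hp, -⟩ ⟨t, h⟩
      exact (hhi hp t).ne (by rw [h])
  refine ⟨T, hT0, connectedComponentIn (range γ)ᶜ a, connectedComponentIn (range γ)ᶜ b,
    hC.connectedComponentIn, hC.connectedComponentIn, isConnected_connectedComponentIn_iff.2 haC,
    isConnected_connectedComponentIn_iff.2 hbC, ?_, ?_, hU, hV⟩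
  · refine eq_empty_of_forall_notMem fun p hp ↦ not_joinedIn_compl_range_of_norm_lt hhom
      (hlo haT) (hhi hbT) ?_
    have hab := (connectedComponentIn_eq hp.1).trans (connectedComponentIn_eq hp.2).symm
    have hpath := hC.connectedComponentIn.isConnected_iff_isPathConnected.1
      (isConnected_connectedComponentIn_iff.2 hbC)
    exact (hpath.joinedIn _ (mem_connectedComponentIn hbC) _
      (hab ▸ mem_connectedComponentIn haC)).mono (connectedComponentIn_subset _ _)
  · refine (union_subset (connectedComponentIn_subset _ _)
      (connectedComponentIn_subset _ _)).antisymm fun p hp ↦ ?_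
    obtain ⟨q, hq, hTq⟩ := exists_mem_connectedComponentIn_compl_range hinj hhom hp T
    rcases lt_abs.1 hTq with h | h
    · right
      rw [connectedComponentIn_eq (hV ⟨h, trivial⟩), ← connectedComponentIn_eq hq]
      exact mem_connectedComponentIn hp
    · left
      rw [connectedComponentIn_eq (hU ⟨lt_neg.1 h, trivial⟩), ← connectedComponentIn_eq hq]
      exact mem_connectedComponentIn hp
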